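/- For all ε > 0, all y, y' ∈ ℝ and all z ∈ ℝ^d, one has |f(y,z) − f(y',z) − a^ε(y,y',z)·(y − y')| ≤ 2L_y ε. -/

import Mathlib

/-- The cut-off function `l^ε(x,x') = 1` if `|x−x'| ≥ ε` and `|x−x'|/ε` otherwise. -/
noncomputable def lEps (ε x x' : ℝ) : ℝ :=
  if ε ≤ |x - x'| then 1 else |x - x'| / ε

/-- The linearization coefficient
`a^ε(y,y',z) = l^ε(y,y')·(f(y,z)−f(y',z))/(y−y') − κ(1−l^ε(y,y'))` for `y ≠ y'`,
and `a^ε(y,y,z) = −κ`. -/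
noncomputable def aEps {d : ℕ} (f : ℝ → EuclideanSpace ℝ (Fin d) → ℝ)
    (κ ε : ℝ) (y y' : ℝ) (z : EuclideanSpace ℝ (Fin d)) : ℝ :=
  if y = y' then -κ
  else lEps ε y y' * ((f y z - f y' z) / (y - y')) - κ * (1 - lEps ε y y')

/-- `|f(y,z) − f(y',z) − a^ε(y,y',z)(y−y')| ≤ 2L_y ε`. -/
theorem stmt7 (d : ℕ) (hd : 1 ≤ d) (Ly Lz : ℝ) (hLy : 0 < Ly) (hLz : 0 < Lz)
    (f : ℝ → EuclideanSpace ℝ (Fin d) → ℝ)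
    (hf : ∀ (y y' : ℝ) (z z' : EuclideanSpace ℝ (Fin d)),
      |f y z - f y' z'| ≤ Ly * |y - y'| + Lz * (1 + ‖z‖ + ‖z'‖) * ‖z - z'‖)
    (κ : ℝ) (hκ : 0 < κ) (hκLy : κ ≤ Ly) (ε : ℝ) (hε : 0 < ε) :
    ∀ (y y' : ℝ) (z : EuclideanSpace ℝ (Fin d)),
      |f y z - f y' z - aEps f κ ε y y' z * (y - y')| ≤ 2 * Ly * ε := by
  intro y y' z
  have h := hf y y' z z
  simp only [sub_self, norm_zero, mul_zero, add_zero] at h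
  unfold aEps
  by_cases hy : y = y'
  · subst hy
    simp only [sub_self, mul_zero, abs_zero]
    positivity
  · rw [if_neg hy]
    have hne : y - y' ≠ 0 := sub_ne_zero.mpr hy
    have key : f y z - f y' z
        - (lEps ε y y' * ((f y z - f y' z) / (y - y')) - κ * (1 - lEps ε y y')) * (y - y')
        = (1 - lEps ε y y') * ((f y z - f y' z) + κ * (y - y')) := by
      field_simp
      ring
    rw [key]
    unfold lEps
    split_ifs with hc
    · simp only [sub_self, zero_mul, abs_zero]
      positivity
    · have hlt : |y - y'| < ε := not_le.mp hc
      have h0 : 0 ≤ |y - y'| / ε := by positivity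
      have h1 : |y - y'| / ε ≤ 1 := (div_le_one hε).mpr hlt.le
      have h2 : |(f y z - f y' z) + κ * (y - y')| ≤ 2 * Ly * ε := by
        have h3 := abs_add_le (f y z - f y' z) (κ * (y - y'))
        rw [abs_mul, abs_of_pos hκ] at h3
        have h4 : κ * |y - y'| ≤ Ly * |y - y'| :=
          mul_le_mul_of_nonneg_right hκLy (abs_nonneg _)
        have h5 : Ly * |y - y'| ≤ Ly * ε := mul_le_mul_of_nonneg_left hlt.le hLy.le
        linarith
      rw [abs_mul, abs_of_nonneg (by linarith : 0 ≤ 1 - |y - y'| / ε)]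
      exact (mul_le_of_le_one_left (abs_nonneg _) (by linarith)).trans h2
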